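/- arXiv:1308.1570 — 3 statements merged into one kernel-verified Lean document; each statement's English description precedes it below -/
import Mathlib

section
/- The completeness defect equals the minimum of the global approximation errors over all interpolation operators, and the minimum is attained: ε_L(V,H) = min{ e^H_V(R) : R ∈ R_L }, i.e. ε_L(V,H) ≤ e^H_V(R) for every R ∈ R_L and there exists R₀ ∈ R_L with e^H_V(R₀) = ε_L(V,H). -/
/-- The completeness defect
`ε_𝓛(V,H) = sup{‖ι w‖_H : w ∈ 𝓛^⊥, ‖w‖_V ≤ 1}` equals the minimum of the global
approximation errors `e^H_V(R) = sup{‖ι u - R u‖_H : ‖u‖_V ≤ 1}` over all interpolation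
operators `R ∈ 𝓡_𝓛` (bounded linear operators `V → H` vanishing on the annihilator
`𝓛^⊥`), and the minimum is attained: `ε_𝓛(V,H) ≤ e^H_V(R)` for every `R ∈ 𝓡_𝓛` and
there exists `R₀ ∈ 𝓡_𝓛` with `e^H_V(R₀) = ε_𝓛(V,H)`. -/
theorem completeness_defect_eq_min_global_approximation_error
    {V H : Type*}
    [NormedAddCommGroup V] [InnerProductSpace ℝ V] [CompleteSpace V]
    [NormedAddCommGroup H] [InnerProductSpace ℝ H] [CompleteSpace H]
    [TopologicalSpace.SeparableSpace V] [TopologicalSpace.SeparableSpace H]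
    (ι : V →L[ℝ] H) (hι_inj : Function.Injective ι) (hι_dense : DenseRange ι)
    {N : ℕ} (l : Fin N → V →L[ℝ] ℝ) :
    (∀ R : V →L[ℝ] H, (∀ v : V, (∀ j, l j v = 0) → R v = 0) →
      sSup {x : ℝ | ∃ w : V, (∀ j, l j w = 0) ∧ ‖w‖ ≤ 1 ∧ x = ‖ι w‖} ≤
        sSup {x : ℝ | ∃ u : V, ‖u‖ ≤ 1 ∧ x = ‖ι u - R u‖}) ∧
    (∃ R₀ : V →L[ℝ] H, (∀ v : V, (∀ j, l j v = 0) → R₀ v = 0) ∧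
      sSup {x : ℝ | ∃ u : V, ‖u‖ ≤ 1 ∧ x = ‖ι u - R₀ u‖} =
        sSup {x : ℝ | ∃ w : V, (∀ j, l j w = 0) ∧ ‖w‖ ≤ 1 ∧ x = ‖ι w‖}) := by
  constructor
  · intro R hR
    refine csSup_le_csSup ⟨‖ι - R‖, ?_⟩ ⟨‖ι 0‖, 0, by simp, by simp, rfl⟩ ?_
    · rintro x ⟨u, hu, rfl⟩
      exact (ι - R).unit_le_opNorm u hu
    · rintro x ⟨w, hw, hw1, rfl⟩
      exact ⟨w, hw1, by rw [hR w hw, sub_zero]⟩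
  · let K : Submodule ℝ V := ⨅ j, (l j).ker
    have mem_K (v : V) : v ∈ K ↔ ∀ j, l j v = 0 := by simp [K]
    have hK_closed : IsClosed (K : Set V) := by
      simp only [K, Submodule.coe_iInf]
      exact isClosed_iInter fun j => (l j).isClosed_ker
    have : CompleteSpace K := hK_closed.completeSpace_coe
    have hR₀ (u : V) : ι u - (ι - ι.comp K.starProjection) u = ι (K.starProjection u) := by simp
    refine ⟨ι - ι.comp K.starProjection, fun v hv => ?_, congrArg sSup (Set.ext fun x => ?_)⟩
    · simp [K.starProjection_eq_self_iff.mpr ((mem_K v).mpr hv)]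
    · constructor
      · rintro ⟨u, hu, rfl⟩
        exact ⟨K.starProjection u, (mem_K _).mp (K.starProjection_apply_mem u),
          (K.norm_starProjection_apply_le u).trans hu, by rw [hR₀]⟩
      · rintro ⟨w, hw, hw1, rfl⟩
        exact ⟨w, hw1, by rw [hR₀, K.starProjection_eq_self_iff.mpr ((mem_K w).mpr hw)]⟩
end

section
/- Let Q_L denote the orthogonal projection of V onto the closed subspace L^⊥ (orthogonality taken with respect to the inner product of V). Then the completeness defect satisfies ε_L(V,H) = sup{‖ι (Q_L u)‖_H : u ∈ V, ‖u‖_V ≤ 1}; equivalently, the operator I − Q_L belongs to R_L and e^H_V(I − Q_L) = ε_L(V,H), so I − Q_L is an optimal interpolation operator. -/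
open scoped RealInnerProductSpace

theorem norm_le_of_inner_sub_self_eq_zero {E : Type*} [NormedAddCommGroup E]
    [InnerProductSpace ℝ E] {u q : E} (h : ⟪u - q, q⟫ = 0) : ‖q‖ ≤ ‖u‖ := by
  have hpyth := norm_add_sq_eq_norm_sq_add_norm_sq_real h
  rw [sub_add_cancel] at hpyth
  nlinarith [norm_nonneg u, norm_nonneg q, mul_self_nonneg ‖u - q‖]

/-- Let `Q` be the orthogonal projection of `V` onto the closed subspace
`𝓛^⊥ = {w : l j w = 0 ∀ j}` (characterized by: `Q v ∈ 𝓛^⊥` and `v - Q v ⊥ 𝓛^⊥` for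
every `v`, with respect to the inner product of `V`). Then the completeness defect
satisfies `ε_𝓛(V,H) = sup{‖ι (Q u)‖_H : ‖u‖_V ≤ 1}`; equivalently, `I - Q` belongs to
`𝓡_𝓛` (it vanishes on `𝓛^⊥`) and its global approximation error
`e^H_V(I - Q) = sup{‖ι u - ι(u - Q u)‖_H : ‖u‖_V ≤ 1} = sup{‖ι (Q u)‖_H : ‖u‖_V ≤ 1}`
equals `ε_𝓛(V,H)`, so `I - Q` is an optimal interpolation operator. -/
theorem completeness_defect_eq_error_of_orthogonal_projection
    {V H : Type*}
    [NormedAddCommGroup V] [InnerProductSpace ℝ V] [CompleteSpace V]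
    [NormedAddCommGroup H] [InnerProductSpace ℝ H] [CompleteSpace H]
    [TopologicalSpace.SeparableSpace V] [TopologicalSpace.SeparableSpace H]
    (ι : V →L[ℝ] H) (hι_inj : Function.Injective ι) (hι_dense : DenseRange ι)
    {N : ℕ} (l : Fin N → V →L[ℝ] ℝ)
    (Q : V →L[ℝ] V)
    (hQ_mem : ∀ v : V, ∀ j, l j (Q v) = 0)
    (hQ_orth : ∀ v w : V, (∀ j, l j w = 0) → ⟪v - Q v, w⟫ = 0) :
    sSup {x : ℝ | ∃ w : V, (∀ j, l j w = 0) ∧ ‖w‖ ≤ 1 ∧ x = ‖ι w‖} =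
      sSup {x : ℝ | ∃ u : V, ‖u‖ ≤ 1 ∧ x = ‖ι (Q u)‖} ∧
    (∀ v : V, (∀ j, l j v = 0) → v - Q v = 0) := by
  have hfix : ∀ v : V, (∀ j, l j v = 0) → v - Q v = 0 := fun v hv =>
    inner_self_eq_zero.mp (hQ_orth v (v - Q v) fun j => by rw [map_sub, hv, hQ_mem, sub_zero])
  refine ⟨?_, hfix⟩
  congr 1
  ext x
  constructor
  · rintro ⟨w, hw, hw1, rfl⟩
    exact ⟨w, hw1, by rw [← sub_eq_zero.mp (hfix w hw)]⟩
  · rintro ⟨u, hu, rfl⟩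
    exact ⟨Q u, hQ_mem u,
      (norm_le_of_inner_sub_self_eq_zero (hQ_orth u (Q u) (hQ_mem u))).trans hu, rfl⟩
end

section
/- Dissipativity of the prognostic values in the smooth norm: in addition to the hypotheses giving ‖u_n‖_H ≤ 1 + ϱ* for n ≥ n* (where ϱ* = (a₁K_G + c₀K)(1 − c₁e^{−a₀α})^{−1}), assume the smoothing property that there is a constant C > 0 with ‖S_t u‖_{W₂} ≤ C whenever t ∈ [α, β] and ‖u‖_H ≤ 1 + ϱ*, and assume ‖w − R w‖_{W₂} ≤ c₂ ‖w‖_{W₂} for all w ∈ W₂ (in particular S_t u ∈ W₂ for such t, u). Then ‖u_n‖_{W₂} ≤ c₂ C + (1 + c₂) K for all n ≥ n* + 1. -/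
/-- Dissipativity of the prognostic values in the smooth norm.
`W` models the subspace `W₂ ⊆ H` with its own norm via an injective linear embedding
`j : W → H`. The prognostic values are `u_{n+1} = (I - R) S_{t_{n+1}-t_n} u_n + R U_{n+1}`
with observation times `α ≤ t_{n+1} - t_n ≤ β` and reference states `U_n ∈ W₂`,
`‖U_n‖_{W₂} ≤ K`. In addition to the hypotheses giving `‖u_n‖_H ≤ 1 + ϱ*` for `n ≥ n*`
(with `ϱ* = (a₁ K_G + c₀ K)/(1 - c₁ e^{-a₀ α})`), assume the smoothing property: there is
`C > 0` with `S s v ∈ W₂` and `‖S s v‖_{W₂} ≤ C` whenever `s ∈ [α, β]` and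
`‖v‖_H ≤ 1 + ϱ*`; and assume `w - R w ∈ W₂` with `‖w - R w‖_{W₂} ≤ c₂ ‖w‖_{W₂}` for all
`w ∈ W₂`. Then `u_n ∈ W₂` and `‖u_n‖_{W₂} ≤ c₂ C + (1 + c₂) K` for all `n ≥ n* + 1`. -/
theorem prognostic_values_dissipative_smooth_norm
    {H W : Type*} [NormedAddCommGroup H] [NormedSpace ℝ H]
    [NormedAddCommGroup W] [NormedSpace ℝ W]
    (j : W →ₗ[ℝ] H) (hj : Function.Injective j)
    (S : ℝ → H → H)
    (a₀ a₁ KG K c₀ c₁ c₂ α β C : ℝ)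
    (ha₀ : 0 < a₀) (ha₁ : 0 < a₁) (hKG : 0 < KG) (hK : 0 < K)
    (hc₀ : 0 < c₀) (hc₁ : 0 < c₁) (hc₂ : 0 < c₂) (hα : 0 < α) (hαβ : α ≤ β)
    (hc₁α : c₁ < Real.exp (a₀ * α)) (hC : 0 < C)
    (R : H →ₗ[ℝ] H)
    (hRc₁ : ∀ v : H, ‖v - R v‖ ≤ c₁ * ‖v‖)
    (hRc₀ : ∀ w : W, ‖R (j w)‖ ≤ c₀ * ‖w‖)
    (hRc₂ : ∀ w : W, ∃ w' : W, j w' = j w - R (j w) ∧ ‖w'‖ ≤ c₂ * ‖w‖)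
    (t : ℕ → ℝ) (ht : ∀ n : ℕ, α ≤ t (n + 1) - t n ∧ t (n + 1) - t n ≤ β)
    (U : ℕ → W) (hU : ∀ n, ‖U n‖ ≤ K)
    (u : ℕ → H)
    (hu : ∀ n : ℕ, u (n + 1) =
      (S (t (n + 1) - t n) (u n) - R (S (t (n + 1) - t n) (u n))) + R (j (U (n + 1))))
    (nstar : ℕ)
    (hbound : ∀ n ≥ nstar,
      ‖u n‖ ≤ 1 + (a₁ * KG + c₀ * K) / (1 - c₁ * Real.exp (-(a₀ * α))))
    (hsmooth : ∀ s : ℝ, α ≤ s → s ≤ β → ∀ v : H,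
      ‖v‖ ≤ 1 + (a₁ * KG + c₀ * K) / (1 - c₁ * Real.exp (-(a₀ * α))) →
      ∃ w : W, j w = S s v ∧ ‖w‖ ≤ C) :
    ∀ n ≥ nstar + 1, ∃ w : W, j w = u n ∧ ‖w‖ ≤ c₂ * C + (1 + c₂) * K := by
  intro n hn
  obtain ⟨m, rfl⟩ : ∃ m, n = m + 1 := ⟨n - 1, by omega⟩
  obtain ⟨w, hw, hwC⟩ := hsmooth _ (ht m).1 (ht m).2 (u m) (hbound m (by omega))
  obtain ⟨w', hw', hw'c⟩ := hRc₂ w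
  obtain ⟨v, hv, hvc⟩ := hRc₂ (U (m + 1))
  refine ⟨w' + (U (m + 1) - v), ?_, ?_⟩
  · rw [map_add, map_sub, hw', hv, hu, hw, sub_sub_cancel]
  · calc ‖w' + (U (m + 1) - v)‖ ≤ ‖w'‖ + (‖U (m + 1)‖ + ‖v‖) :=
          (norm_add_le _ _).trans (by gcongr; exact norm_sub_le _ _)
      _ ≤ c₂ * C + (K + c₂ * K) := by
          have hUK := hU (m + 1)
          gcongr
          · exact hw'c.trans (by gcongr)
          · exact hvc.trans (by gcongr)
      _ = c₂ * C + (1 + c₂) * K := by ring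
end
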